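/- arXiv:1803.05996 — 2 statements merged into one kernel-verified Lean document; each statement's English description precedes it below -/
import Mathlib

section
/- Generalized Grone's theorem: Let G = (V,E) be a chordal undirected simple graph on V = {1,…,n} with maximal cliques C_1, C_2, …, C_p, let α = (α_1,…,α_n) be a partition with N = Σ_{i=1}^n α_i, and let X ∈ S^N be a symmetric matrix, viewed in α-blocks, with X_{ij} = 0 whenever i ≠ j and (i,j) ∉ E. Then there exists a positive semidefinite matrix Y ∈ S^N whose blocks satisfy Y_{ij} = X_{ij} for all i = j and all (i,j) ∈ E (i.e., X has a positive semidefinite completion) if and only if E_{C_k} X E_{C_k}^T is positive semidefinite for every k = 1,…,p. -/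
open Matrix

/-- A maximal clique of a simple graph: a clique not contained in any other clique. -/
def IsMaxClique {V : Type*} (G : SimpleGraph V) (s : Finset V) : Prop :=
  G.IsClique ↑s ∧ ∀ t : Finset V, G.IsClique ↑t → s ⊆ t → s = t

/-- A graph is chordal if every cycle of length greater than three (i.e. of length `k + 4`)
has a chord: an edge between two nonconsecutive vertices of the cycle. -/
def IsChordal {V : Type*} (G : SimpleGraph V) : Prop :=
  ∀ (k : ℕ) (v : Fin (k + 4) → V), Function.Injective v →
    (∀ i, G.Adj (v i) (v (i + 1))) →
    ∃ i j, j ≠ i + 1 ∧ i ≠ j + 1 ∧ G.Adj (v i) (v j)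

/-- The index matrix `E_C ∈ ℝ^{|C| × N}` of a clique `C` for the block partition `α`:
its `(i, j)` block is the identity `I_{α_i}` if `i ∈ C` equals `j`, and `0` otherwise. -/
def indexMatrix {n : ℕ} (α : Fin n → ℕ) (C : Finset (Fin n)) :
    Matrix ((i : {x : Fin n // x ∈ C}) × Fin (α i.1)) ((i : Fin n) × Fin (α i)) ℝ :=
  fun p q => if (p.1 : Fin n) = q.1 ∧ (p.2 : ℕ) = (q.2 : ℕ) then 1 else 0

/-- A shortest walk has no shortcuts. -/
theorem SimpleGraph.Walk.le_succ_of_adj_of_length_eq_dist {V : Type*} {G : SimpleGraph V}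
    {u v : V} (p : G.Walk u v) (hp : p.length = G.dist u v) {i j : ℕ} (hi : i ≤ p.length)
    (hj : j ≤ p.length) (h : G.Adj (p.getVert i) (p.getVert j)) : j ≤ i + 1 := by
  have h1 := SimpleGraph.dist_le (((p.take i).concat h).append (p.drop j))
  simp only [SimpleGraph.Walk.length_append, SimpleGraph.Walk.length_concat,
    SimpleGraph.Walk.take_length, SimpleGraph.Walk.drop_length] at h1
  omega

/-- In a chordal graph, two common neighbors of a vertex `r` that are both attached to a connected
set avoiding `r` and its neighbors are adjacent. -/
theorem IsChordal.adj_of_preconnected {V : Type*} {G : SimpleGraph V} (hG : IsChordal G)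
    {A : Set V} (hA : (G.induce A).Preconnected) {r s t a b : V} (hst : s ≠ t)
    (ha : a ∈ A) (hsa : G.Adj s a) (hb : b ∈ A) (hbt : G.Adj b t)
    (hrs : G.Adj r s) (htr : G.Adj t r) (hr : r ∉ A) (hrA : ∀ x ∈ A, ¬ G.Adj r x) :
    G.Adj s t := by
  by_contra hadj
  have hs1 : (G.induce ({s} ∪ A)).Connected :=
    SimpleGraph.connected_induce_union (v := s) (w := a)
      SimpleGraph.Preconnected.of_subsingleton hA (by simp) ha hsa
  have hcon : (G.induce ({s} ∪ A ∪ {t})).Connected :=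
    SimpleGraph.connected_induce_union (v := b) (w := t)
      hs1.preconnected SimpleGraph.Preconnected.of_subsingleton (Or.inr hb) (by simp) hbt
  obtain ⟨p, hpath, hp⟩ := hcon.exists_path_of_dist ⟨s, by simp⟩ ⟨t, by simp⟩
  obtain ⟨d, hd⟩ : ∃ d, d = p.length := ⟨_, rfl⟩
  let f : ℕ → V := fun i => (p.getVert i : V)
  have hf0 : f 0 = s := congrArg Subtype.val p.getVert_zero
  have hfd : f d = t := hd ▸ congrArg Subtype.val p.getVert_length
  have hsucc : ∀ i < d, G.Adj (f i) (f (i + 1)) := fun i hi => p.adj_getVert_succ (hd ▸ hi)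
  have hchord : ∀ i ≤ d, ∀ j ≤ d, G.Adj (f i) (f j) → j ≤ i + 1 := fun i hi j hj h =>
    p.le_succ_of_adj_of_length_eq_dist hp (hd ▸ hi) (hd ▸ hj) h
  have hinj : ∀ i ≤ d, ∀ j ≤ d, f i = f j → i = j := fun i hi j hj h =>
    hpath.getVert_injOn (hd ▸ hi : i ≤ p.length) (hd ▸ hj : j ≤ p.length) (Subtype.ext h)
  have hmem : ∀ i, f i = s ∨ f i ∈ A ∨ f i = t := fun i => by
    have := (p.getVert i).2
    simp only [Set.mem_union, Set.mem_singleton_iff] at this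
    tauto
  have hd2 : 2 ≤ d := by
    by_contra hlt
    obtain h | h : d = 0 ∨ d = 1 := by omega
    · exact hst (by rw [← hf0, ← hfd, h])
    · exact hadj (by simpa [hf0, ← h, hfd] using hsucc 0 (by omega))
  have hfr : ∀ i, f i ≠ r := fun i h => by
    rcases hmem i with h' | h' | h'
    · exact hrs.ne (h.symm.trans h')
    · exact hr (h ▸ h')
    · exact htr.ne (h'.symm.trans h)
  have hrf : ∀ i ≤ d, G.Adj r (f i) → i = 0 ∨ i = d := fun i hi h => by
    rcases hmem i with h' | h' | h'
    · exact Or.inl (hinj i hi 0 (Nat.zero_le _) (h'.trans hf0.symm))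
    · exact absurd h (hrA _ h')
    · exact Or.inr (hinj i hi d le_rfl (h'.trans hfd.symm))
  obtain ⟨k, rfl⟩ : ∃ k, d = k + 2 := ⟨d - 2, by omega⟩
  let w : Fin (k + 4) → V := fun i => if (i : ℕ) = k + 3 then r else f i
  have hval : ∀ i : Fin (k + 4), ((i + 1 : Fin (k + 4)) : ℕ) =
      if (i : ℕ) = k + 3 then 0 else (i : ℕ) + 1 := fun i => by
    have := Fin.val_add_one i
    simpa [Fin.ext_iff] using this
  obtain ⟨i, j, hij, hji, h⟩ := hG k w
    (fun i j h => by
      have := i.2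
      have := j.2
      simp only [w] at h
      split_ifs at h with h1 h2 h2
      · exact Fin.ext (h1.trans h2.symm)
      · exact absurd h.symm (hfr _)
      · exact absurd h (hfr _)
      · exact Fin.ext (hinj _ (by omega) _ (by omega) h))
    (fun i => by
      have hi := i.2
      by_cases h1 : (i : ℕ) = k + 3
      · simpa [w, hval, h1, hf0] using hrs
      by_cases h2 : (i : ℕ) = k + 2
      · simpa [w, hval, h2, hfd] using htr
      · simpa [w, hval, h1, h2] using hsucc i (by omega))
  have hi := i.2
  have hj := j.2
  rw [Ne, Fin.ext_iff, hval] at hij hji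
  simp only [w] at h
  split_ifs at h hij hji with h1 h2 h2
  · exact G.loopless.irrefl _ h
  · have := hrf _ (by omega) h
    omega
  · have := hrf _ (by omega) h.symm
    omega
  · have := hchord _ (by omega) _ (by omega) h
    have := hchord _ (by omega) _ (by omega) h.symm
    have : (i : ℕ) ≠ j := fun e => G.loopless.irrefl _ (e ▸ h)
    omega

/-- A finite set of vertices of a chordal graph that is not a clique decomposes into two proper
subsets that overlap in a clique and have no further edges between them. -/
theorem IsChordal.exists_clique_separation {V : Type*} {G : SimpleGraph V}
    (hG : IsChordal G) (U : Finset V) (hU : ¬ G.IsClique (U : Set V)) :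
    ∃ A B : Finset V, A ⊂ U ∧ B ⊂ U ∧ G.IsClique ((A : Set V) ∩ B) ∧
      ∀ x ∈ U, ∀ y ∈ U, (x = y ∨ G.Adj x y) → (x ∈ A ∧ y ∈ A) ∨ (x ∈ B ∧ y ∈ B) := by
  classical
  let N : Finset V → Finset V := fun A => {x ∈ U | x ∈ A ∨ ∃ a ∈ A, G.Adj x a}
  let F : Finset (Finset V) := {A ∈ U.powerset | A.Nonempty ∧
    (G.induce (A : Set V)).Preconnected ∧ N A ≠ U}
  have hF : F.Nonempty := by
    simp only [SimpleGraph.IsClique, Set.Pairwise] at hU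
    push Not at hU
    obtain ⟨a, ha, b, hb, hab, h⟩ := hU
    refine ⟨{a}, ?_⟩
    simp only [F, Finset.mem_filter, Finset.mem_powerset, Finset.singleton_subset_iff]
    refine ⟨ha, by simp, ?_, fun e => ?_⟩
    · rw [Finset.coe_singleton]
      exact SimpleGraph.Preconnected.of_subsingleton
    · have : b ∈ N {a} := e ▸ hb
      simp only [N, Finset.mem_filter, Finset.mem_singleton, exists_eq_left] at this
      exact this.2.elim (fun e => hab e.symm) fun e : G.Adj b a => h e.symm
  obtain ⟨A, hAF, hmax⟩ := Finset.exists_max_image F Finset.card hF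
  simp only [F, Finset.mem_filter, Finset.mem_powerset] at hAF hmax
  obtain ⟨hAU, ⟨a₀, ha₀⟩, hAc, hAN⟩ := hAF
  have hNU : N A ⊆ U := Finset.filter_subset _ _
  obtain ⟨r, hrU, hrN⟩ := Finset.exists_of_ssubset (hNU.ssubset_of_ne hAN)
  have hr : r ∉ A ∧ ∀ a ∈ A, ¬ G.Adj r a := by
    simp only [N, Finset.mem_filter, not_and, not_or, not_exists] at hrN
    exact hrN hrU
  have key : ∀ s ∈ N A, s ∉ A → G.Adj r s := by
    intro s hs hsA
    obtain ⟨hsU, hs⟩ := Finset.mem_filter.1 hs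
    obtain ⟨a, ha, hsa⟩ := hs.resolve_left hsA
    by_contra hrs
    have hle := hmax (insert s A) ⟨Finset.insert_subset hsU hAU, Finset.insert_nonempty _ _, by
      rw [Finset.coe_insert, Set.insert_eq]
      exact (SimpleGraph.connected_induce_union (v := s) (w := a)
        SimpleGraph.Preconnected.of_subsingleton hAc (by simp) ha hsa).preconnected, fun e => by
      have : r ∈ N (insert s A) := e ▸ hrU
      obtain ⟨-, h | ⟨x, hx, hrx⟩⟩ := Finset.mem_filter.1 this
      · rcases Finset.mem_insert.1 h with rfl | h
        · exact hr.2 a ha hsa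
        · exact hr.1 h
      · rcases Finset.mem_insert.1 hx with rfl | h
        · exact hrs hrx
        · exact hr.2 x h hrx⟩
    rw [Finset.card_insert_of_notMem hsA] at hle
    omega
  refine ⟨N A, U \ A, hNU.ssubset_of_ne hAN,
    Finset.sdiff_ssubset hAU ⟨a₀, ha₀⟩, ?_, fun x hx y hy hxy => ?_⟩
  · rintro s ⟨hs, hs'⟩ t ⟨ht, ht'⟩ hst
    have hsA := (Finset.mem_sdiff.1 hs').2
    have htA := (Finset.mem_sdiff.1 ht').2
    obtain ⟨a, ha, hsa⟩ := (Finset.mem_filter.1 hs).2.resolve_left hsA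
    obtain ⟨b, hb, htb⟩ := (Finset.mem_filter.1 ht).2.resolve_left htA
    exact hG.adj_of_preconnected hAc hst ha hsa hb htb.symm (key s hs hsA) (key t ht htA).symm
      hr.1 hr.2
  · have memN : ∀ x ∈ U, ∀ y ∈ A, (x = y ∨ G.Adj x y) → x ∈ N A := fun x hx y hy h =>
      Finset.mem_filter.2 ⟨hx, h.imp (fun e : x = y => e ▸ hy) fun e => ⟨y, hy, e⟩⟩
    by_cases hxA : x ∈ A
    · exact Or.inl ⟨memN x hx x hxA (Or.inl rfl), memN y hy x hxA (hxy.imp Eq.symm fun e => e.symm)⟩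
    by_cases hyA : y ∈ A
    · exact Or.inl ⟨memN x hx y hyA hxy, memN y hy y hyA (Or.inl rfl)⟩
    · exact Or.inr ⟨Finset.mem_sdiff.2 ⟨hx, hxA⟩, Finset.mem_sdiff.2 ⟨hy, hyA⟩⟩

open scoped MatrixOrder in
/-- A real positive semidefinite matrix is a Gram matrix. -/
theorem Matrix.PosSemidef.exists_eq_gram {ι : Type*} [Fintype ι] {Y : Matrix ι ι ℝ}
    (hY : Y.PosSemidef) : ∃ u : ι → EuclideanSpace ℝ ι, Y = Matrix.gram ℝ u := by
  classical
  obtain ⟨B, rfl⟩ := CStarAlgebra.nonneg_iff_eq_star_mul_self.1 hY.nonneg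
  refine ⟨fun i => WithLp.toLp 2 fun k => B k i, ?_⟩
  ext i j
  simp [Matrix.mul_apply, PiLp.inner_apply, mul_comm]

/-- Two finite families of vectors with the same Gram matrix differ by a linear isometry of the
ambient space. -/
theorem exists_linearIsometry_of_gram_eq {ι V : Type*} [Fintype ι] [NormedAddCommGroup V]
    [InnerProductSpace ℝ V] [FiniteDimensional ℝ V] {u w : ι → V}
    (h : Matrix.gram ℝ u = Matrix.gram ℝ w) : ∃ L : V →ₗᵢ[ℝ] V, ∀ i, L (u i) = w i := by
  classical
  let T := Fintype.linearCombination ℝ u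
  let T' := Fintype.linearCombination ℝ w
  have hnorm : ∀ c, ‖T' c‖ = ‖T c‖ := fun c => by
    rw [← sq_eq_sq₀ (norm_nonneg _) (norm_nonneg _), ← real_inner_self_eq_norm_sq,
      ← real_inner_self_eq_norm_sq]
    simp only [T, T', Fintype.linearCombination_apply]
    rw [← Matrix.star_dotProduct_gram_mulVec, ← Matrix.star_dotProduct_gram_mulVec, h]
  obtain ⟨g, hg⟩ := T.rangeRestrict.exists_rightInverse_of_surjective T.range_rangeRestrict
  have hTg : ∀ x, T (g x) = x := fun x => congrArg Subtype.val (LinearMap.congr_fun hg x)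
  let L : LinearMap.range T →ₗᵢ[ℝ] V := ⟨T' ∘ₗ g, fun x => by
    rw [LinearMap.comp_apply, hnorm, hTg, Submodule.coe_norm]⟩
  refine ⟨L.extend, fun i => ?_⟩
  have hTu : T (Pi.single i 1) = u i := by simp [T]
  have hTw : T' (Pi.single i 1) = w i := by simp [T']
  let x : LinearMap.range T := ⟨u i, Pi.single i 1, hTu⟩
  have hL : L.extend (u i) = T' (g x) := L.extend_apply x
  rw [hL, ← sub_eq_zero, ← hTw, ← map_sub, ← norm_eq_zero, hnorm, map_sub, hTg, hTu, sub_self,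
    norm_zero]

/-- Positive semidefinite matrices that agree on the overlap `P ∩ Q` can be glued along it. -/
theorem Matrix.PosSemidef.exists_glue {ι : Type*} [Fintype ι] {Y Z : Matrix ι ι ℝ}
    (hY : Y.PosSemidef) (hZ : Z.PosSemidef) (P Q : Set ι)
    (hYZ : ∀ i ∈ P ∩ Q, ∀ j ∈ P ∩ Q, Y i j = Z i j) :
    ∃ W : Matrix ι ι ℝ, W.PosSemidef ∧ (∀ i ∈ P, ∀ j ∈ P, W i j = Y i j) ∧
      ∀ i ∈ Q, ∀ j ∈ Q, W i j = Z i j := by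
  classical
  obtain ⟨u, rfl⟩ := hY.exists_eq_gram
  obtain ⟨w, rfl⟩ := hZ.exists_eq_gram
  obtain ⟨L, hL⟩ := exists_linearIsometry_of_gram_eq
    (u := fun i : (P ∩ Q : Set ι) => u i) (w := fun i => w i) (by
      ext i j
      exact hYZ i i.2 j j.2)
  let z : ι → EuclideanSpace ℝ ι := fun i => if i ∈ P then L (u i) else w i
  have hz : ∀ i ∈ Q, z i = w i := fun i hi => by
    by_cases h : i ∈ P
    · simpa [z, h] using hL ⟨i, h, hi⟩
    · simp [z, h]
  refine ⟨Matrix.gram ℝ z, Matrix.posSemidef_gram ℝ z, fun i hi j hj => ?_, fun i hi j hj => ?_⟩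
  · simp [z, hi, hj]
  · simp [hz i hi, hz j hj]

theorem indexMatrix_eq_submatrix_one {n : ℕ} (α : Fin n → ℕ) (C : Finset (Fin n)) :
    indexMatrix α C = (1 : Matrix ((i : Fin n) × Fin (α i)) ((i : Fin n) × Fin (α i)) ℝ).submatrix
      (Sigma.map Subtype.val fun _ => id) id := by
  ext ⟨i, a⟩ ⟨j, b⟩
  simp only [indexMatrix, Matrix.submatrix_apply, Matrix.one_apply, Sigma.map, id]
  congr 1
  rw [Sigma.mk.injEq, eq_iff_iff]
  refine and_congr_right fun h => ?_
  subst h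
  rw [heq_eq_eq, Fin.ext_iff]

theorem indexMatrix_mul_mul_transpose {n : ℕ} (α : Fin n → ℕ) (C : Finset (Fin n))
    (X : Matrix ((i : Fin n) × Fin (α i)) ((i : Fin n) × Fin (α i)) ℝ) :
    indexMatrix α C * X * (indexMatrix α C)ᵀ =
      X.submatrix (Sigma.map Subtype.val fun _ => id) (Sigma.map Subtype.val fun _ => id) := by
  rw [indexMatrix_eq_submatrix_one, Matrix.transpose_submatrix, Matrix.transpose_one]
  ext p q
  simp [Matrix.mul_apply, Matrix.one_apply]

theorem indexMatrix_mul_transpose_self {n : ℕ} (α : Fin n → ℕ) (C : Finset (Fin n)) :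
    indexMatrix α C * (indexMatrix α C)ᵀ = 1 := by
  have h := indexMatrix_mul_mul_transpose α C 1
  rw [Matrix.mul_one] at h
  rw [h, Matrix.submatrix_one _ (Subtype.val_injective.sigma_map fun _ => Function.injective_id)]

theorem exists_posSemidef_of_indexMatrix {n : ℕ} (α : Fin n → ℕ) (C : Finset (Fin n))
    (X : Matrix ((i : Fin n) × Fin (α i)) ((i : Fin n) × Fin (α i)) ℝ)
    (h : (indexMatrix α C * X * (indexMatrix α C)ᵀ).PosSemidef) :
    ∃ Y : Matrix ((i : Fin n) × Fin (α i)) ((i : Fin n) × Fin (α i)) ℝ, Y.PosSemidef ∧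
      ∀ i ∈ C, ∀ j ∈ C, ∀ (a : Fin (α i)) (b : Fin (α j)), Y ⟨i, a⟩ ⟨j, b⟩ = X ⟨i, a⟩ ⟨j, b⟩ := by
  set E := indexMatrix α C
  refine ⟨Eᵀ * (E * X * Eᵀ) * E, by simpa using h.conjTranspose_mul_mul_same E,
    fun i hi j hj a b => ?_⟩
  have hE : E * Eᵀ = 1 := indexMatrix_mul_transpose_self α C
  have key : E * (Eᵀ * (E * X * Eᵀ) * E) * Eᵀ = E * X * Eᵀ := by
    calc _ = E * Eᵀ * (E * X * Eᵀ) * (E * Eᵀ) := by simp only [Matrix.mul_assoc]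
      _ = _ := by rw [hE, Matrix.one_mul, Matrix.mul_one]
  have key' := (indexMatrix_mul_mul_transpose α C _).symm.trans
    (key.trans (indexMatrix_mul_mul_transpose α C X))
  exact congrFun (congrFun key' ⟨⟨i, hi⟩, a⟩) ⟨⟨j, hj⟩, b⟩

theorem SimpleGraph.IsClique.exists_isMaxClique {V : Type*} [Fintype V] {G : SimpleGraph V}
    {s : Finset V} (hs : G.IsClique (s : Set V)) : ∃ t, IsMaxClique G t ∧ s ⊆ t := by
  obtain ⟨t, hst, ht⟩ := (Set.toFinite {t : Finset V | G.IsClique (t : Set V)}).exists_le_maximal hs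
  exact ⟨t, ⟨ht.prop, fun t' h hle => ht.eq_of_le h hle⟩, hst⟩

/-- In a chordal graph, a matrix all of whose clique submatrices extend to positive semidefinite
matrices has a positive semidefinite completion on every finite set of vertices. -/
theorem IsChordal.exists_posSemidef_completion {V : Type*} [Fintype V] {G : SimpleGraph V}
    (hG : IsChordal G) {β : V → Type*} [∀ i, Fintype (β i)]
    (X : Matrix ((i : V) × β i) ((i : V) × β i) ℝ)
    (hX : ∀ s : Finset V, G.IsClique (s : Set V) →
      ∃ Y : Matrix ((i : V) × β i) ((i : V) × β i) ℝ, Y.PosSemidef ∧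
        ∀ i ∈ s, ∀ j ∈ s, ∀ (a : β i) (b : β j), Y ⟨i, a⟩ ⟨j, b⟩ = X ⟨i, a⟩ ⟨j, b⟩)
    (U : Finset V) :
    ∃ Y : Matrix ((i : V) × β i) ((i : V) × β i) ℝ, Y.PosSemidef ∧
      ∀ i ∈ U, ∀ j ∈ U, (i = j ∨ G.Adj i j) →
        ∀ (a : β i) (b : β j), Y ⟨i, a⟩ ⟨j, b⟩ = X ⟨i, a⟩ ⟨j, b⟩ := by
  induction U using Finset.strongInduction with
  | H U ih =>
    by_cases hU : G.IsClique (U : Set V)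
    · obtain ⟨Y, hY, h⟩ := hX U hU
      exact ⟨Y, hY, fun i hi j hj _ => h i hi j hj⟩
    · obtain ⟨A, B, hA, hB, hAB, hcover⟩ := hG.exists_clique_separation U hU
      obtain ⟨Y, hY, hYX⟩ := ih A hA
      obtain ⟨Z, hZ, hZX⟩ := ih B hB
      obtain ⟨W, hW, hWY, hWZ⟩ := hY.exists_glue hZ {x | x.1 ∈ A} {x | x.1 ∈ B} (by
        rintro ⟨i, a⟩ ⟨hiA, hiB⟩ ⟨j, b⟩ ⟨hjA, hjB⟩
        have hij : i = j ∨ G.Adj i j := or_iff_not_imp_left.2 (hAB ⟨hiA, hiB⟩ ⟨hjA, hjB⟩)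
        rw [hYX i hiA j hjA hij, hZX i hiB j hjB hij])
      refine ⟨W, hW, fun i hi j hj hij a b => ?_⟩
      rcases hcover i hi j hj hij with ⟨h, h'⟩ | ⟨h, h'⟩
      · rw [hWY _ h _ h', hYX i h j h' hij]
      · rw [hWZ _ h _ h', hZX i h j h' hij]

/-- **Generalized Grone's theorem.** Let `G` be a chordal graph on `{1,…,n}` with maximal
cliques `C_1, …, C_p`, and let `X ∈ S^N` be symmetric with `α`-blocks vanishing outside the
pattern of `G`. Then `X` has a positive semidefinite completion (a PSD matrix `Y` whose blocks
agree with those of `X` on the diagonal and on the edges of `G`) if and only if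
`E_{C_k} X E_{C_k}ᵀ ⪰ 0` for every `k`. -/
theorem generalized_grone
    {n p : ℕ} (G : SimpleGraph (Fin n))
    (hchordal : IsChordal G)
    (C : Fin p → Finset (Fin n))
    (hC : ∀ s : Finset (Fin n), IsMaxClique G s ↔ ∃ k, s = C k)
    (α : Fin n → ℕ)
    (X : Matrix ((i : Fin n) × Fin (α i)) ((i : Fin n) × Fin (α i)) ℝ)
    (hXsym : X.IsHermitian)
    (hXsparse : ∀ i j : Fin n, i ≠ j → ¬ G.Adj i j →
      ∀ (a : Fin (α i)) (b : Fin (α j)), X ⟨i, a⟩ ⟨j, b⟩ = 0) :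
    (∃ Y : Matrix ((i : Fin n) × Fin (α i)) ((i : Fin n) × Fin (α i)) ℝ,
        Y.PosSemidef ∧
        ∀ i j : Fin n, (i = j ∨ G.Adj i j) →
          ∀ (a : Fin (α i)) (b : Fin (α j)), Y ⟨i, a⟩ ⟨j, b⟩ = X ⟨i, a⟩ ⟨j, b⟩) ↔
    (∀ k : Fin p,
      (indexMatrix α (C k) * X * (indexMatrix α (C k))ᵀ).PosSemidef) := by
  constructor
  · rintro ⟨Y, hY, hYX⟩ k
    have hclique := ((hC (C k)).2 ⟨k, rfl⟩).1
    have hsub := hY.submatrix (Sigma.map Subtype.val fun _ => id :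
      ((i : {x : Fin n // x ∈ C k}) × Fin (α i.1)) → (i : Fin n) × Fin (α i))
    rw [indexMatrix_mul_mul_transpose]
    convert hsub using 1
    ext ⟨⟨i, hi⟩, a⟩ ⟨⟨j, hj⟩, b⟩
    exact (hYX i j (or_iff_not_imp_left.2 (hclique hi hj)) a b).symm
  · intro h
    obtain ⟨Y, hY, hYX⟩ := hchordal.exists_posSemidef_completion X (fun s hs => by
      obtain ⟨t, ht, hst⟩ := hs.exists_isMaxClique
      obtain ⟨k, rfl⟩ := (hC t).1 ht
      obtain ⟨Y, hY, hYX⟩ := exists_posSemidef_of_indexMatrix α (C k) X (h k)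
      exact ⟨Y, hY, fun i hi j hj => hYX i (hst hi) j (hst hj)⟩) Finset.univ
    exact ⟨Y, hY, fun i j => hYX i (Finset.mem_univ i) j (Finset.mem_univ j)⟩
end

section
/- Generalized Agler's theorem: Let G = (V,E) be a chordal undirected simple graph on V = {1,…,n} with maximal cliques C_1, C_2, …, C_p, let α = (α_1,…,α_n) be a partition with N = Σ_{i=1}^n α_i, and let Z ∈ S^N be a symmetric matrix, viewed in α-blocks, with Z_{ij} = 0 whenever i ≠ j and (i,j) ∉ E. Then Z is positive semidefinite if and only if there exist positive semidefinite matrices Z_k ∈ S^{|C_k|} for k = 1,…,p such that Z = Σ_{k=1}^p E_{C_k}^T Z_k E_{C_k}. -/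
open Matrix

/-- The graph on the same vertices keeping only the edges of `G` with both ends in `S`. -/
def SimpleGraph.keepOn {V : Type*} (G : SimpleGraph V) (S : Set V) : SimpleGraph V where
  Adj a b := G.Adj a b ∧ a ∈ S ∧ b ∈ S
  symm := ⟨fun _ _ h => ⟨h.1.symm, h.2.2, h.2.1⟩⟩
  loopless := ⟨fun a h => G.loopless.irrefl a h.1⟩

/-- A vertex pair along a walk of minimal length that is adjacent is consecutive. -/
theorem SimpleGraph.Walk.le_succ_of_adj_getVert {V : Type*} {H : SimpleGraph V} {x y : V}
    (w : H.Walk x y) (hw : w.length = H.dist x y) {i j : ℕ} (hi : i ≤ w.length)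
    (hj : j ≤ w.length) (h : H.Adj (w.getVert i) (w.getVert j)) : j ≤ i + 1 := by
  have := SimpleGraph.dist_le ((w.take i).append (.cons h (w.drop j)))
  simp only [SimpleGraph.Walk.length_append, SimpleGraph.Walk.length_cons,
    SimpleGraph.Walk.take_length, SimpleGraph.Walk.drop_length] at this
  omega

/-- In a chordal graph, two neighbours of `u` joined by a path through vertices that are not
neighbours of `u` are adjacent. -/
theorem IsChordal.adj_of_reachable {V : Type*} {G : SimpleGraph V} (hG : IsChordal G)
    {A : Set V} {u x y : V} (huA : u ∉ A) (hA : ∀ a ∈ A, ¬ G.Adj u a) (hux : G.Adj u x)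
    (huy : G.Adj u y) (hxy : x ≠ y) (hr : (G.keepOn (A ∪ {x, y})).Reachable x y) :
    G.Adj x y := by
  by_contra hnadj
  obtain ⟨w, hw⟩ := hr.exists_walk_length_eq_dist
  have hp := w.isPath_of_length_eq_dist hw
  have hadj : ∀ i < w.length, (G.keepOn (A ∪ {x, y})).Adj (w.getVert i) (w.getVert (i + 1)) :=
    fun i hi => w.adj_getVert_succ hi
  have hlen : 2 ≤ w.length := by
    by_contra hlt
    have h0 : w.length ≠ 0 := fun h => hxy (SimpleGraph.Walk.eq_of_length_eq_zero h)
    have h1 : w.length = 1 := by omega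
    have := hadj 0 (by omega)
    rw [SimpleGraph.Walk.getVert_zero, zero_add, ← h1, SimpleGraph.Walk.getVert_length] at this
    exact hnadj this.1
  have hinj : ∀ i ≤ w.length, ∀ j ≤ w.length, w.getVert i = w.getVert j → i = j :=
    fun i hi j hj h => hp.getVert_injOn hi hj h
  have hmem : ∀ i ≤ w.length, w.getVert i ∈ A ∪ {x, y} := by
    intro i hi
    rcases hi.lt_or_eq with h | rfl
    · exact (hadj i h).2.1
    · simp
  have hends : ∀ i ≤ w.length, G.Adj u (w.getVert i) → i = 0 ∨ i = w.length := by
    intro i hi h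
    rcases hmem i hi with h' | h' | h'
    · exact absurd h (hA _ h')
    · exact Or.inl (hinj i hi 0 (by omega) (by simpa using h'))
    · exact Or.inr (hinj i hi _ le_rfl (by simpa using h'))
  have hune : ∀ i ≤ w.length, w.getVert i ≠ u := by
    intro i hi h
    rcases hmem i hi with h' | h' | h'
    · exact huA (h ▸ h')
    · exact G.ne_of_adj hux (h.symm.trans h')
    · exact G.ne_of_adj huy (h.symm.trans h')
  have hconsec : ∀ i ≤ w.length, ∀ j ≤ w.length, G.Adj (w.getVert i) (w.getVert j) →
      j ≤ i + 1 := fun i hi j hj h =>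
    w.le_succ_of_adj_getVert hw hi hj ⟨h, hmem i hi, hmem j hj⟩
  obtain ⟨k, hk⟩ := Nat.exists_eq_add_of_le hlen
  have hsucc : ∀ i : Fin (k + 4), (i + 1).val = if i.val = k + 3 then 0 else i.val + 1 := by
    intro i
    rw [Fin.val_add_one]
    simp [Fin.ext_iff]
  have hsucc_eq : ∀ i j : Fin (k + 4), j.val = (if i.val = k + 3 then 0 else i.val + 1) →
      j = i + 1 := fun i j h => Fin.ext (h.trans (hsucc i).symm)
  obtain ⟨i, j, hij, hji, h⟩ := hG k
    (fun i => if i.val = k + 3 then u else w.getVert i.val) (by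
      intro i j h
      have hi := i.isLt
      have hj := j.isLt
      apply Fin.ext
      by_cases h1 : i.val = k + 3 <;> by_cases h2 : j.val = k + 3 <;>
        simp only [h1, h2, if_true, if_false] at h ⊢
      · exact absurd h.symm (hune _ (by omega))
      · exact absurd h (hune _ (by omega))
      · exact hinj _ (by omega) _ (by omega) h) (by
      intro i
      have hi := i.isLt
      simp only [hsucc]
      by_cases h1 : i.val = k + 3
      · simpa [h1] using hux
      · by_cases h2 : i.val + 1 = k + 3
        · have : i.val = w.length := by omega
          rw [if_neg h1, if_neg h1, if_pos h2, this, SimpleGraph.Walk.getVert_length]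
          exact huy.symm
        · rw [if_neg h1, if_neg h1, if_neg h2]
          exact (hadj i.val (by omega)).1)
  have hi := i.isLt
  have hj := j.isLt
  by_cases h1 : i.val = k + 3 <;> by_cases h2 : j.val = k + 3 <;>
    simp only [h1, h2, if_true, if_false] at h
  · exact G.irrefl h
  · rcases hends _ (by omega) h with h0 | h0
    · exact hij (hsucc_eq _ _ (by rw [if_pos h1, h0]))
    · exact hji (hsucc_eq _ _ (by rw [if_neg h2]; omega))
  · rcases hends _ (by omega) h.symm with h0 | h0
    · exact hji (hsucc_eq _ _ (by rw [if_pos h2, h0]))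
    · exact hij (hsucc_eq _ _ (by rw [if_neg h1]; omega))
  · have a1 := hconsec _ (by omega) _ (by omega) h
    have a2 := hconsec _ (by omega) _ (by omega) h.symm
    have a3 : i.val ≠ j.val := fun e => G.irrefl (e ▸ h)
    rcases (by omega : j.val = i.val + 1 ∨ i.val = j.val + 1) with e | e
    · exact hij (hsucc_eq _ _ (by rw [if_neg h1, e]))
    · exact hji (hsucc_eq _ _ (by rw [if_neg h2, e]))

/-- **Dirac's lemma**, relative form: if `u ∈ T` has a non-neighbour in `T`, then the subgraph of a
chordal graph induced on `T` has a simplicial vertex outside the closed neighbourhood of `u`. -/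
theorem IsChordal.exists_simplicial_not_adj {V : Type*} {G : SimpleGraph V} (hG : IsChordal G)
    (T : Finset V) : ∀ u ∈ T, (∃ v ∈ T, v ≠ u ∧ ¬ G.Adj u v) →
      ∃ v ∈ T, v ≠ u ∧ ¬ G.Adj u v ∧
        ∀ a ∈ T, ∀ b ∈ T, G.Adj v a → G.Adj v b → a ≠ b → G.Adj a b := by
  classical
  induction T using Finset.strongInduction with
  | H T ih =>
  rintro u huT ⟨a₀, ha₀T, ha₀u, ha₀⟩
  set S : Set V := {a | a ∈ T ∧ a ≠ u ∧ ¬ G.Adj u a} with hS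
  set A : Set V := {a | (G.keepOn S).Reachable a₀ a} with hAdef
  have ha₀A : a₀ ∈ A := SimpleGraph.Reachable.refl a₀
  have hAS : A ⊆ S := by
    intro a ha
    rw [hAdef, Set.mem_ofPred_eq, SimpleGraph.reachable_iff_reflTransGen] at ha
    rcases Relation.ReflTransGen.cases_tail ha with h | ⟨b, _, h⟩
    · exact h ▸ ⟨ha₀T, ha₀u, ha₀⟩
    · exact h.2.2
  have hAcl : ∀ a ∈ A, ∀ b ∈ S, G.Adj a b → b ∈ A := fun a ha b hb h =>
    SimpleGraph.Reachable.trans ha (SimpleGraph.Adj.reachable ⟨h, hAS ha, hb⟩)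
  have hAr : ∀ S' : Set V, A ⊆ S' → ∀ a ∈ A, (G.keepOn S').Reachable a₀ a := by
    intro S' hS' a ha
    have ha' := ha
    rw [hAdef, Set.mem_ofPred_eq, SimpleGraph.reachable_iff_reflTransGen] at ha'
    induction ha' with
    | refl => exact SimpleGraph.Reachable.refl _
    | @tail b c hb hbc ih' =>
      have hbA : b ∈ A := (SimpleGraph.reachable_iff_reflTransGen _ _).2 hb
      exact (ih' hbA).trans (SimpleGraph.Adj.reachable ⟨hbc.1, hS' hbA, hS' ha⟩)
  set B : Set V := {b | b ∈ T ∧ b ∉ A ∧ ∃ a ∈ A, G.Adj a b} with hB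
  have hBu : ∀ b ∈ B, G.Adj u b := by
    rintro b ⟨hbT, hbA, a, ha, hab⟩
    by_contra h
    refine hbA (hAcl a ha b ⟨hbT, ?_, h⟩ hab)
    rintro rfl
    exact (hAS ha).2.2 hab.symm
  have hBclique : ∀ x ∈ B, ∀ y ∈ B, x ≠ y → G.Adj x y := by
    intro x hx y hy hxy
    obtain ⟨-, -, a, ha, hax⟩ := id hx
    obtain ⟨-, -, b, hb, hby⟩ := id hy
    refine hG.adj_of_reachable (A := A) (fun h => (hAS h).2.1 rfl) (fun a ha => (hAS ha).2.2)
      (hBu x hx) (hBu y hy) hxy ?_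
    have h1 := hAr (A ∪ {x, y}) Set.subset_union_left a ha
    have h2 := hAr (A ∪ {x, y}) Set.subset_union_left b hb
    have h3 : (G.keepOn (A ∪ {x, y})).Adj a x := ⟨hax, Or.inl ha, by simp⟩
    have h4 : (G.keepOn (A ∪ {x, y})).Adj b y := ⟨hby, Or.inl hb, by simp⟩
    exact (h3.reachable.symm.trans h1.symm).trans (h2.trans h4.reachable)
  set T' : Finset V := T.filter (fun v => v ∈ A ∨ v ∈ B) with hT'
  have hT'mem : ∀ v, v ∈ T' ↔ v ∈ A ∨ v ∈ B := by
    intro v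
    rw [hT', Finset.mem_filter]
    exact ⟨And.right, fun h => ⟨h.elim (fun h => (hAS h).1) (fun h => h.1), h⟩⟩
  have hT'T : T' ⊂ T := by
    refine Finset.ssubset_iff_subset_ne.2 ⟨Finset.filter_subset _ _, fun h => ?_⟩
    rcases (hT'mem u).1 (h ▸ huT) with h | h
    · exact (hAS h).2.1 rfl
    · exact G.irrefl (hBu u h)
  have hnbr : ∀ v ∈ A, ∀ a ∈ T, G.Adj v a → a ∈ T' := by
    intro v hv a ha hva
    rw [hT'mem]
    by_cases h : a ∈ A
    · exact Or.inl h
    · exact Or.inr ⟨ha, h, v, hv, hva⟩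
  suffices h : ∃ v ∈ A, ∀ a ∈ T', ∀ b ∈ T', G.Adj v a → G.Adj v b → a ≠ b → G.Adj a b by
    obtain ⟨v, hv, h⟩ := h
    exact ⟨v, (hAS hv).1, (hAS hv).2.1, (hAS hv).2.2, fun a ha b hb hva hvb =>
      h a (hnbr v hv a ha hva) b (hnbr v hv b hb hvb) hva hvb⟩
  by_cases hc1 : ∃ w ∈ B, ∃ v ∈ T', v ≠ w ∧ ¬ G.Adj w v
  · obtain ⟨w, hw, hwv⟩ := hc1
    obtain ⟨v, hv, hvw, hnadj, hsimp⟩ := ih T' hT'T w ((hT'mem w).2 (Or.inr hw)) hwv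
    refine ⟨v, ?_, hsimp⟩
    rcases (hT'mem v).1 hv with h | h
    · exact h
    · exact absurd (hBclique w hw v h hvw.symm) hnadj
  push Not at hc1
  by_cases hc2 : ∃ w ∈ A, ∃ v ∈ T', v ≠ w ∧ ¬ G.Adj w v
  · obtain ⟨w, hw, hwv⟩ := hc2
    have hwT' := (hT'mem w).2 (Or.inl hw)
    obtain ⟨v, hv, hvw, hnadj, hsimp⟩ := ih T' hT'T w hwT' hwv
    refine ⟨v, ?_, hsimp⟩
    rcases (hT'mem v).1 hv with h | h
    · exact h
    · exact absurd (hc1 v h w hwT' hvw.symm).symm hnadj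
  push Not at hc2
  refine ⟨a₀, ha₀A, fun a ha b hb _ _ hab => ?_⟩
  rcases (hT'mem a).1 ha with h | h
  · exact hc2 a h b hb hab.symm
  · exact hc1 a h b hb hab.symm

/-- Every nonempty set of vertices of a chordal graph has a simplicial vertex. -/
theorem IsChordal.exists_simplicial {V : Type*} {G : SimpleGraph V} (hG : IsChordal G)
    {T : Finset V} (hT : T.Nonempty) :
    ∃ v ∈ T, ∀ a ∈ T, ∀ b ∈ T, G.Adj v a → G.Adj v b → a ≠ b → G.Adj a b := by
  by_cases h : ∃ u ∈ T, ∃ v ∈ T, v ≠ u ∧ ¬ G.Adj u v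
  · obtain ⟨u, hu, huv⟩ := h
    obtain ⟨v, hv, -, -, hs⟩ := hG.exists_simplicial_not_adj T u hu huv
    exact ⟨v, hv, hs⟩
  · push Not at h
    obtain ⟨v, hv⟩ := hT
    exact ⟨v, hv, fun a ha b hb _ _ hab => h a ha b hb hab.symm⟩

/-- A zero diagonal entry of a positive semidefinite matrix forces its row to vanish. -/
theorem Matrix.PosSemidef.row_eq_zero {I : Type*} {Z : Matrix I I ℝ} (hZ : Z.PosSemidef)
    {i : I} (hi : Z i i = 0) (j : I) : Z i j = 0 := by
  have h := (hZ.submatrix ![i, j]).det_nonneg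
  have hs : Z j i = Z i j := by simpa using hZ.1.apply i j
  rw [Matrix.det_fin_two] at h
  simp [hi, hs] at h
  nlinarith [h]

/-- Eliminating one variable from a positive semidefinite matrix leaves a positive semidefinite
Schur complement. -/
theorem Matrix.PosSemidef.sub_vecMulVec {I : Type*} [Fintype I] [DecidableEq I]
    {Z : Matrix I I ℝ} (hZ : Z.PosSemidef) (i : I) :
    (Z - (Z i i)⁻¹ • Matrix.vecMulVec (Z i) (Z i)).PosSemidef := by
  have hs : ∀ a b, Z a b = Z b a := fun a b => by simpa using hZ.1.apply b a
  have h := hZ.conjTranspose_mul_mul_same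
    (1 - (Z i i)⁻¹ • Matrix.vecMulVec (Pi.single i 1) (Z i))
  convert h using 1
  have e1 : Z * Matrix.vecMulVec (Pi.single i 1) (Z i) = Matrix.vecMulVec (Z i) (Z i) := by
    rw [Matrix.mul_vecMulVec]
    congr 1
    ext a
    simp [hs i a]
  have e2 : Matrix.vecMulVec (Z i) (Pi.single i 1) * Z = Matrix.vecMulVec (Z i) (Z i) := by
    rw [Matrix.vecMulVec_mul]
    congr 1
    ext a
    simp
  have e3 : Matrix.vecMulVec (Z i) (Pi.single i 1) * Matrix.vecMulVec (Z i) (Z i) =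
      Z i i • Matrix.vecMulVec (Z i) (Z i) := by
    rw [Matrix.vecMulVec_mul_vecMulVec]
    ext a b
    simp only [Matrix.vecMulVec_apply, Matrix.smul_apply, Pi.smul_apply, smul_eq_mul,
      single_dotProduct, one_mul]
    ring
  have e4 : ((1 : Matrix I I ℝ) - (Z i i)⁻¹ • Matrix.vecMulVec (Pi.single i 1) (Z i))ᴴ =
      1 - (Z i i)⁻¹ • Matrix.vecMulVec (Z i) (Pi.single i 1) := by
    ext a b
    simp [Matrix.vecMulVec_apply, Matrix.one_apply, eq_comm, mul_comm]
  have e5 : (Z i i)⁻¹ * (Z i i)⁻¹ * Z i i = (Z i i)⁻¹ := by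
    by_cases h0 : Z i i = 0
    · simp [h0]
    · field_simp
  rw [e4, Matrix.mul_assoc, Matrix.mul_sub, Matrix.mul_smul, e1, Matrix.sub_mul, Matrix.one_mul,
    Matrix.mul_one, Matrix.smul_mul, Matrix.mul_sub, e2, Matrix.mul_smul, e3, smul_sub,
    smul_smul, smul_smul, e5]
  abel

/-- A positive semidefinite matrix whose sparsity pattern is a chordal graph is a sum of
positive semidefinite matrices, each supported on a clique. -/
theorem IsChordal.exists_posSemidef_decomposition {V I κ : Type*} [Fintype I] [DecidableEq I]
    [Fintype κ] {G : SimpleGraph V} (hG : IsChordal G) (C : κ → Finset V)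
    (hC : ∀ s : Finset V, G.IsClique ↑s → ∃ k, s ⊆ C k) (π : I → V) {Z : Matrix I I ℝ}
    (hZ : Z.PosSemidef) (hsparse : ∀ i j, π i ≠ π j → ¬ G.Adj (π i) (π j) → Z i j = 0) :
    ∃ Y : κ → Matrix I I ℝ, (∀ k, (Y k).PosSemidef) ∧
      (∀ k i j, Y k i j ≠ 0 → π i ∈ C k ∧ π j ∈ C k) ∧ Z = ∑ k, Y k := by
  classical
  suffices h : ∀ (S : Finset I) (Z : Matrix I I ℝ), Z.PosSemidef →
      (∀ i j, π i ≠ π j → ¬ G.Adj (π i) (π j) → Z i j = 0) →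
      (∀ i j, Z i j ≠ 0 → i ∈ S) → ∃ Y : κ → Matrix I I ℝ, (∀ k, (Y k).PosSemidef) ∧
      (∀ k i j, Y k i j ≠ 0 → π i ∈ C k ∧ π j ∈ C k) ∧ Z = ∑ k, Y k from
    h Finset.univ Z hZ hsparse fun _ _ _ => Finset.mem_univ _
  intro S
  induction S using Finset.strongInduction with
  | H S ih =>
  intro Z hZ hsparse hsupp
  rcases S.eq_empty_or_nonempty with rfl | hS
  · refine ⟨0, fun _ => Matrix.PosSemidef.zero, fun k i j h => absurd rfl h, ?_⟩
    ext i j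
    by_contra h
    simp only [Pi.zero_apply, Finset.sum_const_zero, Matrix.zero_apply] at h
    exact absurd (hsupp i j h) (by simp)
  obtain ⟨v, hv, hsimp⟩ := hG.exists_simplicial (hS.image π)
  obtain ⟨i, hiS, rfl⟩ := Finset.mem_image.1 hv
  have hs : ∀ a b, Z a b = Z b a := fun a b => by simpa using hZ.1.apply b a
  have hnbr : ∀ a, Z i a ≠ 0 → π a ∈ S.image π ∧ (π a = π i ∨ G.Adj (π i) (π a)) := by
    intro a ha
    refine ⟨Finset.mem_image_of_mem _ (hsupp a i (hs a i ▸ ha)), ?_⟩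
    by_contra! h
    exact ha (hsparse i a h.1.symm h.2)
  have hpair : ∀ a b, Z i a ≠ 0 → Z i b ≠ 0 → π a ≠ π b → G.Adj (π a) (π b) := by
    intro a b ha hb hab
    obtain ⟨haS, ha⟩ := hnbr a ha
    obtain ⟨hbS, hb⟩ := hnbr b hb
    rcases ha with ha | ha <;> rcases hb with hb | hb
    · exact absurd (ha.trans hb.symm) hab
    · exact ha ▸ hb
    · exact hb ▸ ha.symm
    · exact hsimp _ haS _ hbS ha hb hab
  obtain ⟨k₀, hk₀⟩ := hC ((Finset.univ.filter fun a => Z i a ≠ 0).image π) (by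
    intro x hx y hy hxy
    simp only [Finset.coe_image, Set.mem_image, Finset.coe_filter, Finset.mem_univ, true_and,
      Set.mem_ofPred_eq] at hx hy
    obtain ⟨a, ha, rfl⟩ := hx
    obtain ⟨b, hb, rfl⟩ := hy
    exact hpair a b ha hb hxy)
  have hmem : ∀ a, Z i a ≠ 0 → π a ∈ C k₀ := fun a ha =>
    hk₀ (Finset.mem_image_of_mem _ (by simpa using ha))
  set R : Matrix I I ℝ := (Z i i)⁻¹ • Matrix.vecMulVec (Z i) (Z i) with hR
  have hRapp : ∀ a b, R a b = (Z i i)⁻¹ * (Z i a * Z i b) := fun a b => by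
    simp [hR, Matrix.vecMulVec_apply]
  have hRne : ∀ a b, R a b ≠ 0 → Z i a ≠ 0 ∧ Z i b ≠ 0 := by
    intro a b h
    rw [hRapp] at h
    exact mul_ne_zero_iff.1 (right_ne_zero_of_mul h)
  have hRpsd : R.PosSemidef := by
    have h := Matrix.posSemidef_vecMulVec_self_star (Z i)
    rw [star_trivial] at h
    exact h.smul (inv_nonneg.2 hZ.diag_nonneg)
  obtain ⟨Y, hY, hYsupp, hYsum⟩ := ih (S.erase i) (Finset.erase_ssubset hiS) (Z - R)
    (hZ.sub_vecMulVec i) (by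
      intro a b hab hnadj
      have h : R a b = 0 := by
        by_contra h
        exact hnadj (hpair a b (hRne a b h).1 (hRne a b h).2 hab)
      rw [Matrix.sub_apply, hsparse a b hab hnadj, h, sub_zero]) (by
      intro a b h
      refine Finset.mem_erase.2 ⟨?_, ?_⟩
      · rintro rfl
        apply h
        rw [Matrix.sub_apply, hRapp]
        by_cases h0 : Z a a = 0
        · simp [h0, hZ.row_eq_zero h0 b]
        · field_simp
          simp
      · by_contra ha
        have hz : ∀ c, Z a c = 0 := fun c => by
          by_contra hne
          exact ha (hsupp a c hne)
        exact h (by rw [Matrix.sub_apply, hRapp, hz, hs i a, hz]; simp))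
  refine ⟨fun k => Y k + if k = k₀ then R else 0, fun k => ?_, fun k a b h => ?_, ?_⟩
  · refine (hY k).add ?_
    split_ifs
    · exact hRpsd
    · exact Matrix.PosSemidef.zero
  · by_cases hYk : Y k a b = 0
    · by_cases hk : k = k₀
      · subst hk
        have h' := hRne a b (by simpa [hYk] using h)
        exact ⟨hmem a h'.1, hmem b h'.2⟩
      · simp [hYk, hk] at h
    · exact hYsupp k a b hYk
  · rw [Finset.sum_add_distrib, ← hYsum, Finset.sum_ite_eq' Finset.univ k₀]
    simp

/-- Every clique of a finite graph is contained in a maximal clique. -/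
theorem exists_isMaxClique_superset {V : Type*} [Finite V] (G : SimpleGraph V) {s : Finset V}
    (hs : G.IsClique ↑s) : ∃ t, IsMaxClique G t ∧ s ⊆ t := by
  obtain ⟨t, hst, ht⟩ := (Set.toFinite {t : Finset V | G.IsClique ↑t}).exists_le_maximal hs
  exact ⟨t, ⟨ht.prop, fun r hr htr => ht.eq_of_le hr htr⟩, hst⟩

/-- The inclusion of the scalar indices of the blocks in `C` into all scalar indices. -/
def blockInclusion {n : ℕ} (α : Fin n → ℕ) (C : Finset (Fin n))
    (i : (i : {x : Fin n // x ∈ C}) × Fin (α i.1)) : (i : Fin n) × Fin (α i) :=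
  ⟨i.1.1, i.2⟩

/-- Inflating the principal block submatrix indexed by `C` recovers a matrix supported on `C`. -/
theorem indexMatrix_inflate_submatrix {n : ℕ} (α : Fin n → ℕ) (C : Finset (Fin n))
    (Y : Matrix ((i : Fin n) × Fin (α i)) ((i : Fin n) × Fin (α i)) ℝ)
    (hY : ∀ i j, Y i j ≠ 0 → i.1 ∈ C ∧ j.1 ∈ C) :
    (indexMatrix α C)ᵀ * Y.submatrix (blockInclusion α C) (blockInclusion α C) *
      indexMatrix α C = Y := by
  have hentry : ∀ (p : (i : {x : Fin n // x ∈ C}) × Fin (α i.1)) (q : (i : Fin n) × Fin (α i)),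
      indexMatrix α C p q = if (⟨p.1.1, p.2⟩ : (i : Fin n) × Fin (α i)) = q then 1 else 0 := by
    rintro ⟨⟨i, hi⟩, a⟩ ⟨j, b⟩
    simp only [indexMatrix]
    congr 1
    apply propext
    constructor
    · rintro ⟨h1, h2⟩
      subst h1
      rw [Fin.ext h2]
    · intro h
      cases h
      exact ⟨rfl, rfl⟩
  ext q r
  have hpick : ∀ (q : (i : Fin n) × Fin (α i)) (f : (i : Fin n) × Fin (α i) → ℝ),
      (q.1 ∉ C → f q = 0) →
      ∑ p : (i : {x : Fin n // x ∈ C}) × Fin (α i.1),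
        f ⟨p.1.1, p.2⟩ * indexMatrix α C p q = f q := by
    rintro ⟨j, b⟩ f hf
    by_cases hj : j ∈ C
    · rw [Finset.sum_eq_single (⟨⟨j, hj⟩, b⟩ : (i : {x : Fin n // x ∈ C}) × Fin (α i.1))]
      · simp [hentry]
      · rintro ⟨⟨i, hi⟩, a⟩ - hne
        rw [hentry, if_neg, mul_zero]
        intro h
        cases h
        exact hne rfl
      · simp
    · rw [hf hj]
      refine Finset.sum_eq_zero ?_
      rintro ⟨⟨i, hi⟩, a⟩ -
      rw [hentry, if_neg, mul_zero]
      intro h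
      cases h
      exact hj hi
  have hrow : ∀ s : (i : {x : Fin n // x ∈ C}) × Fin (α i.1),
      ((indexMatrix α C)ᵀ * Y.submatrix (blockInclusion α C) (blockInclusion α C)) q s =
        Y q ⟨s.1.1, s.2⟩ := by
    intro s
    rw [Matrix.mul_apply, ← hpick q (fun t => Y t ⟨s.1.1, s.2⟩) (fun h => by
      by_contra hne
      exact h (hY _ _ hne).1)]
    exact Finset.sum_congr rfl fun t _ => mul_comm _ _
  rw [Matrix.mul_apply]
  simp only [hrow]
  exact hpick r (fun t => Y q t) (fun h => by
    by_contra hne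
    exact h (hY _ _ hne).2)

/-- **Generalized Agler's theorem.** Let `G` be a chordal graph on `{1,…,n}` with maximal
cliques `C_1, …, C_p`, and let `Z ∈ S^N` be symmetric with `α`-blocks vanishing outside the
pattern of `G`. Then `Z ⪰ 0` if and only if there exist matrices `Z_k ⪰ 0` of clique size
such that `Z = ∑ₖ E_{C_k}ᵀ Z_k E_{C_k}`. -/
theorem generalized_agler
    {n p : ℕ} (G : SimpleGraph (Fin n))
    (hchordal : IsChordal G)
    (C : Fin p → Finset (Fin n))
    (hC : ∀ s : Finset (Fin n), IsMaxClique G s ↔ ∃ k, s = C k)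
    (α : Fin n → ℕ)
    (Z : Matrix ((i : Fin n) × Fin (α i)) ((i : Fin n) × Fin (α i)) ℝ)
    (hZsym : Z.IsHermitian)
    (hZsparse : ∀ i j : Fin n, i ≠ j → ¬ G.Adj i j →
      ∀ (a : Fin (α i)) (b : Fin (α j)), Z ⟨i, a⟩ ⟨j, b⟩ = 0) :
    Z.PosSemidef ↔
    (∃ Zk : (k : Fin p) →
        Matrix ((i : {x : Fin n // x ∈ C k}) × Fin (α i.1))
               ((i : {x : Fin n // x ∈ C k}) × Fin (α i.1)) ℝ,
      (∀ k, (Zk k).PosSemidef) ∧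
      Z = ∑ k : Fin p, (indexMatrix α (C k))ᵀ * Zk k * indexMatrix α (C k)) := by
  constructor
  · intro hZ
    obtain ⟨Y, hY, hYsupp, hYsum⟩ := hchordal.exists_posSemidef_decomposition C
      (fun s hs => by
        obtain ⟨t, ht, hst⟩ := exists_isMaxClique_superset G hs
        obtain ⟨k, rfl⟩ := (hC t).1 ht
        exact ⟨k, hst⟩)
      Sigma.fst hZ (fun i j hij hadj => hZsparse i.1 j.1 hij hadj i.2 j.2)
    refine ⟨fun k => (Y k).submatrix (blockInclusion α (C k)) (blockInclusion α (C k)),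
      fun k => (hY k).submatrix _, hYsum.trans (Finset.sum_congr rfl fun k _ => ?_)⟩
    exact (indexMatrix_inflate_submatrix α (C k) (Y k) (hYsupp k)).symm
  · rintro ⟨Zk, hZk, rfl⟩
    refine Matrix.posSemidef_sum _ fun k _ => ?_
    simpa using (hZk k).conjTranspose_mul_mul_same (indexMatrix α (C k))
end
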